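/- Let X = Y = ℂ⁴ and let ρ_k = |φ_k⟩⟨φ_k| for k = 1, 2, 3, 4 be the Yu–Duan–Ying states. There exists a separable measurement {P_1, P_2, P_3, P_4} on X : Y whose success probability at discriminating ρ_1, ρ_2, ρ_3, ρ_4 with uniform prior 1/4 equals 3/4; that is, (1/4) Σ_{k=1}^{4} Tr(ρ_k P_k) = 3/4, so the bound 3/4 is attained (e.g. by measuring both systems in the standard basis and guessing appropriately). -/

import Mathlib

open Matrix Complex
open scoped Matrix Kronecker ComplexOrder

noncomputable section

/-- The tensor (Kronecker) product of two vectors. -/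
def tens {α β : Type*} (u : α → ℂ) (v : β → ℂ) : α × β → ℂ := fun p => u p.1 * v p.2

/-- The rank-one operator `u u*`. -/
def proj {α : Type*} (u : α → ℂ) : Matrix α α ℂ := Matrix.vecMulVec u (star u)

/-- A separable (positive semidefinite) operator with respect to the bipartition `α : β`. -/
def SepMat {α β : Type*} [Fintype α] [Fintype β] (P : Matrix (α × β) (α × β) ℂ) : Prop :=
  ∃ (M : ℕ) (Q : Fin M → Matrix α α ℂ) (R : Fin M → Matrix β β ℂ),
    (∀ j, (Q j).PosSemidef) ∧ (∀ j, (R j).PosSemidef) ∧ P = ∑ j, Q j ⊗ₖ R j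

/-- The operator `(1 ⊗ y)* H (1 ⊗ y)` on the first factor. -/
def blockCompress {α β : Type*} [Fintype β] (H : Matrix (α × β) (α × β) ℂ) (y : β → ℂ) :
    Matrix α α ℂ :=
  Matrix.of fun i j => ∑ a, ∑ b, star (y a) * H (i, a) (j, b) * y b

/-- Block positivity with respect to the bipartition `α : β`. -/
def BlockPositive {α β : Type*} [Fintype α] [Fintype β] (H : Matrix (α × β) (α × β) ℂ) : Prop :=
  ∀ y : β → ℂ, (blockCompress H y).PosSemidef

/-- Partial transposition on the first tensor factor. -/
def ptFst {α β : Type*} (M : Matrix (α × β) (α × β) ℂ) : Matrix (α × β) (α × β) ℂ :=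
  Matrix.of fun r c => M (c.1, r.2) (r.1, c.2)

/-- The Yu–Duan–Ying states in `ℂ⁴ ⊗ ℂ⁴`. -/
def ydyVec : Fin 4 → (Fin 4 × Fin 4) → ℂ :=
  ![fun p => if p.1 = p.2 then 1 / 2 else 0,
    fun p => if (p.1 : ℕ) + (p.2 : ℕ) = 3 then 1 / 2 else 0,
    fun p => if p = (0, 3) ∨ p = (1, 2) then 1 / 2
             else if p = (2, 1) ∨ p = (3, 0) then -(1 / 2) else 0,
    fun p => if p = (0, 1) ∨ p = (1, 0) then 1 / 2
             else if p = (2, 3) ∨ p = (3, 2) then -(1 / 2) else 0]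

/-- Guess made after observing the standard-basis outcome `p`. -/
def ydyGuess (p : Fin 4 × Fin 4) : Fin 4 :=
  if p.1 = p.2 then 0
  else if (p.1 : ℕ) + (p.2 : ℕ) = 3 then 1
  else if p = (0, 1) ∨ p = (1, 0) ∨ p = (2, 3) ∨ p = (3, 2) then 3 else 2

/-- Diagonal 0/1 operators are separable. -/
lemma sepMat_diagonal (d : Fin 4 × Fin 4 → ℂ) (hd : ∀ p, 0 ≤ d p) :
    SepMat (Matrix.diagonal d) := by
  refine ⟨4, fun i => Matrix.diagonal (fun a => if a = i then 1 else 0),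
    fun i => Matrix.diagonal (fun b => d (i, b)), ?_, ?_, ?_⟩
  · intro i
    refine Matrix.PosSemidef.diagonal ?_
    intro a
    by_cases h : a = i <;> simp [h]
  · intro i
    exact Matrix.PosSemidef.diagonal fun b => hd (i, b)
  · ext ⟨a, b⟩ ⟨a', b'⟩
    rw [Matrix.sum_apply]
    simp only [Matrix.kroneckerMap_apply, Matrix.diagonal_apply, Prod.mk.injEq]
    by_cases h : a = a' <;> by_cases h' : b = b' <;> simp [h, h']

/-- There is a separable measurement whose success probability at discriminating the four
Yu–Duan–Ying states (uniform prior) is exactly `3/4`, so the bound `3/4` is attained. -/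
theorem ydy_sep_bound_attained :
    ∃ P : Fin 4 → Matrix (Fin 4 × Fin 4) (Fin 4 × Fin 4) ℂ,
      (∀ k, SepMat (P k)) ∧ (∑ k, P k = 1) ∧
      (1 / 4 : ℝ) * ∑ k : Fin 4, ((proj (ydyVec k) * P k).trace).re = 3 / 4 := by
  refine ⟨fun k => Matrix.diagonal (fun p => if ydyGuess p = k then 1 else 0), ?_, ?_, ?_⟩
  · intro k
    refine sepMat_diagonal _ fun p => ?_
    split_ifs <;> simp
  · ext p q
    rw [Matrix.sum_apply]
    by_cases h : p = q <;> simp [Matrix.diagonal_apply, Matrix.one_apply, h]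
  · simp only [Matrix.trace, Matrix.diag_apply, Matrix.mul_diagonal, proj,
      Matrix.vecMulVec_apply, Fintype.sum_prod_type, Fin.sum_univ_four, ydyVec, ydyGuess]
    simp
    norm_num
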